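/- Let p > 0 and q > 0 with p·q ≥ 1, and let θ ∈ (0,1]. Then the lower and upper θ-intermediate dimensions of the attenuated topologist's sine curve T_{p,q} both equal 1, i.e. lodim_θ(T_{p,q}) = updim_θ(T_{p,q}) = 1. -/

import Mathlib

open Set Metric Filter

/-- The upper θ-intermediate dimension of a set `E` in a metric space:
the infimum of all `s ≥ 0` such that for every `ε > 0` there is `δ₀ > 0` such that for all
`0 < δ < δ₀` there is a countable cover `𝒰` of `E` with `δ ≤ diam U ≤ δ ^ θ` for all `U ∈ 𝒰`
and `∑_{U ∈ 𝒰} (diam U) ^ s ≤ ε`. -/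
noncomputable def updim {X : Type*} [PseudoMetricSpace X] (θ : ℝ) (E : Set X) : ℝ :=
  sInf {s : ℝ | 0 ≤ s ∧ ∀ ε : ℝ, 0 < ε → ∃ δ₀ : ℝ, 0 < δ₀ ∧ ∀ δ : ℝ, 0 < δ → δ < δ₀ →
    ∃ 𝒰 : Set (Set X), 𝒰.Countable ∧ E ⊆ ⋃₀ 𝒰 ∧
      (∀ U ∈ 𝒰, δ ≤ diam U ∧ diam U ≤ δ ^ θ) ∧
      ∑' U : 𝒰, ENNReal.ofReal (diam (U : Set X) ^ s) ≤ ENNReal.ofReal ε}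

/-- The lower θ-intermediate dimension of a set `E` in a metric space. -/
noncomputable def lodim {X : Type*} [PseudoMetricSpace X] (θ : ℝ) (E : Set X) : ℝ :=
  sInf {s : ℝ | 0 ≤ s ∧ ∀ ε : ℝ, 0 < ε → ∀ δ₀ : ℝ, 0 < δ₀ → ∃ δ : ℝ, 0 < δ ∧ δ < δ₀ ∧
    ∃ 𝒰 : Set (Set X), 𝒰.Countable ∧ E ⊆ ⋃₀ 𝒰 ∧
      (∀ U ∈ 𝒰, δ ≤ diam U ∧ diam U ≤ δ ^ θ) ∧
      ∑' U : 𝒰, ENNReal.ofReal (diam (U : Set X) ^ s) ≤ ENNReal.ofReal ε}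

/-- The attenuated topologist's sine curve
`T_{p,q} = {(t^{-p}, t^{-pq} sin(πt)) : t ≥ 1} ⊆ ℝ²`. -/
noncomputable def attenTopSine (p q : ℝ) : Set (EuclideanSpace ℝ (Fin 2)) :=
  {x | ∃ t : ℝ, 1 ≤ t ∧ x 0 = t ^ (-p) ∧ x 1 = t ^ (-(p * q)) * Real.sin (Real.pi * t)}

lemma aux_dist_le (x y : EuclideanSpace ℝ (Fin 2)) :
    dist x y ≤ |x 0 - y 0| + |x 1 - y 1| := by
  rw [EuclideanSpace.dist_eq, Fin.sum_univ_two, Real.dist_eq, Real.dist_eq]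
  apply Real.sqrt_le_iff.2
  refine ⟨by positivity, ?_⟩
  nlinarith [abs_nonneg (x 0 - y 0), abs_nonneg (x 1 - y 1),
    mul_nonneg (abs_nonneg (x 0 - y 0)) (abs_nonneg (x 1 - y 1))]

lemma aux_lip_fst (p : ℝ) (hp : 0 < p) (u v : ℝ) (hu : 0 ≤ u) (hv : 0 ≤ v) :
    |Real.exp (-p * u) - Real.exp (-p * v)| ≤ p * |u - v| := by
  have := (convex_Ici (0 : ℝ)).norm_image_sub_le_of_norm_hasDerivWithin_le
    (f := fun u => Real.exp (-p * u)) (f' := fun u => Real.exp (-p * u) * (-p)) (C := p)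
    (fun x _ => by
      have h : HasDerivAt (fun u : ℝ => -p * u) (-p) x := by
        simpa using (hasDerivAt_id x).const_mul (-p)
      exact h.exp.hasDerivWithinAt)
    (fun x hx => by
      have hx' : 0 ≤ x := hx
      have h1 : Real.exp (-p * x) ≤ 1 := Real.exp_le_one_iff.2 (by nlinarith)
      rw [norm_mul, Real.norm_eq_abs, Real.norm_eq_abs, abs_neg, abs_of_pos hp,
        abs_of_pos (Real.exp_pos _)]
      nlinarith) (mem_Ici.2 hv) (mem_Ici.2 hu)
  simpa [Real.norm_eq_abs] using this

lemma aux_lip_snd (r : ℝ) (hr : 1 ≤ r) (u v : ℝ) (hu : 0 ≤ u) (hv : 0 ≤ v) :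
    |Real.exp (-r * u) * Real.sin (Real.pi * Real.exp u)
      - Real.exp (-r * v) * Real.sin (Real.pi * Real.exp v)| ≤ (r + Real.pi) * |u - v| := by
  have := (convex_Ici (0 : ℝ)).norm_image_sub_le_of_norm_hasDerivWithin_le
    (f := fun u => Real.exp (-r * u) * Real.sin (Real.pi * Real.exp u))
    (f' := fun u => (Real.exp (-r * u) * (-r)) * Real.sin (Real.pi * Real.exp u)
      + Real.exp (-r * u) * (Real.cos (Real.pi * Real.exp u) * (Real.pi * Real.exp u)))
    (C := r + Real.pi)
    (fun x _ => by
      have h : HasDerivAt (fun u : ℝ => -r * u) (-r) x := by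
        simpa using (hasDerivAt_id x).const_mul (-r)
      exact (h.exp.mul (((Real.hasDerivAt_exp x).const_mul Real.pi).sin)).hasDerivWithinAt)
    (fun x hx => by
      have hx' : 0 ≤ x := hx
      have h1 : Real.exp (-r * x) ≤ 1 := Real.exp_le_one_iff.2 (by nlinarith)
      have h2 : Real.exp (-r * x) * Real.exp x ≤ 1 := by
        rw [← Real.exp_add]
        exact Real.exp_le_one_iff.2 (by nlinarith)
      have h0 := Real.exp_pos (-r * x)
      have h0' := Real.exp_pos x
      have hpi := Real.pi_pos
      refine (norm_add_le _ _).trans (add_le_add ?_ ?_)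
      · rw [norm_mul, norm_mul, Real.norm_eq_abs, Real.norm_eq_abs, Real.norm_eq_abs, abs_neg,
          abs_of_pos (by linarith : 0 < r), abs_of_pos h0]
        have h3 := Real.abs_sin_le_one (Real.pi * Real.exp x)
        calc _ ≤ (1 * r) * 1 := by gcongr
          _ = r := by ring
      · rw [norm_mul, norm_mul, Real.norm_eq_abs, Real.norm_eq_abs, Real.norm_eq_abs,
          abs_of_pos (mul_pos hpi h0'), abs_of_pos h0]
        have h3 := Real.abs_cos_le_one (Real.pi * Real.exp x)
        calc _ ≤ Real.exp (-r * x) * (1 * (Real.pi * Real.exp x)) := by gcongr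
          _ = (Real.exp (-r * x) * Real.exp x) * Real.pi := by ring
          _ ≤ 1 * Real.pi := by gcongr
          _ = Real.pi := one_mul _) (mem_Ici.2 hv) (mem_Ici.2 hu)
  simpa [Real.norm_eq_abs] using this

/-- A grid of step `η` on `[0, L]`. -/
lemma aux_grid (L η x : ℝ) (hη : 0 < η) (hx : 0 ≤ x) (hxL : x ≤ L) :
    ∃ k ∈ Finset.range (⌊L / η⌋₊ + 1), |x - k * η| ≤ η := by
  refine ⟨⌊x / η⌋₊, ?_, ?_⟩
  · rw [Finset.mem_range]
    exact Nat.lt_succ_of_le (Nat.floor_le_floor (by gcongr))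
  · have h1 := Nat.floor_le (div_nonneg hx hη.le)
    have h2 := Nat.lt_floor_add_one (x / η)
    rw [le_div_iff₀ hη] at h1
    rw [div_lt_iff₀ hη] at h2
    rw [abs_le]
    constructor <;> nlinarith

/-- Centers of balls of radius `δ / 2` covering the curve. -/
lemma aux_centers (p q δ : ℝ) (hp : 0 < p) (hpq : 1 ≤ p * q) (hδ : 0 < δ) (hδ1 : δ < 1) :
    ∃ F : Finset (EuclideanSpace ℝ (Fin 2)),
      (∀ x ∈ attenTopSine p q, ∃ c ∈ F, dist x c ≤ δ / 2) ∧
      (F.card : ℝ) ≤ (6 + 2 * (p + p * q + Real.pi) * Real.log (4 / δ)) / δ := by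
  classical
  set r := p * q with hr
  set K := p + r + Real.pi with hK
  have hpi := Real.pi_pos
  have hK0 : 0 < K := by positivity
  set η := δ / (2 * K) with hη
  have hη0 : 0 < η := by positivity
  set L := Real.log (4 / δ) with hL
  have h4 : 1 < 4 / δ := by rw [lt_div_iff₀ hδ]; linarith
  have hL0 : 0 < L := Real.log_pos h4
  let c1 : ℕ → EuclideanSpace ℝ (Fin 2) := fun k => !₂[k * (δ / 4), 0]
  let c2 : ℕ → EuclideanSpace ℝ (Fin 2) := fun k =>
    !₂[Real.exp (-p * (k * η)), Real.exp (-r * (k * η)) * Real.sin (Real.pi * Real.exp (k * η))]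
  refine ⟨(Finset.range (⌊1 / (δ / 4)⌋₊ + 1)).image c1 ∪
    (Finset.range (⌊L / η⌋₊ + 1)).image c2, ?_, ?_⟩
  · rintro x ⟨t, ht, hx0, hx1⟩
    have ht0 : 0 < t := by linarith
    by_cases htM : t ≤ 4 / δ
    · have hu : 0 ≤ Real.log t := Real.log_nonneg ht
      obtain ⟨k, hk, hk'⟩ := aux_grid L η (Real.log t) hη0 hu (Real.log_le_log ht0 htM)
      refine ⟨c2 k, Finset.mem_union_right _ (Finset.mem_image_of_mem _ hk), ?_⟩
      refine (aux_dist_le _ _).trans ?_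
      have e0 : x 0 = Real.exp (-p * Real.log t) := by
        rw [hx0, Real.rpow_def_of_pos ht0, mul_comm]
      have e1 : x 1 = Real.exp (-r * Real.log t) * Real.sin (Real.pi * Real.exp (Real.log t)) := by
        rw [hx1, Real.rpow_def_of_pos ht0, mul_comm (Real.log t), Real.exp_log ht0]
      have hk0 : 0 ≤ (k : ℝ) * η := by positivity
      have l0 := aux_lip_fst p hp (Real.log t) (k * η) hu hk0
      have l1 := aux_lip_snd r hpq (Real.log t) (k * η) hu hk0
      rw [e0, e1]
      have hKη : K * η = δ / 2 := by rw [hη]; field_simp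
      have : K * |Real.log t - k * η| ≤ K * η := by gcongr
      simp only [c2, PiLp.toLp_apply, Matrix.cons_val_zero, Matrix.cons_val_one]
      nlinarith
    · push Not at htM
      have hx01 : x 0 ≤ 1 := by
        rw [hx0]; exact Real.rpow_le_one_of_one_le_of_nonpos ht (by linarith)
      have hx00 : 0 ≤ x 0 := by rw [hx0]; positivity
      obtain ⟨k, hk, hk'⟩ := aux_grid 1 (δ / 4) (x 0) (by positivity) hx00 hx01
      refine ⟨c1 k, Finset.mem_union_left _ (Finset.mem_image_of_mem _ hk), ?_⟩
      refine (aux_dist_le _ _).trans ?_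
      have h1 : |x 1| ≤ δ / 4 := by
        rw [hx1, abs_mul, abs_of_nonneg (by positivity)]
        calc t ^ (-r) * |Real.sin (Real.pi * t)| ≤ t ^ (-1 : ℝ) * 1 := by
              gcongr
              exact Real.abs_sin_le_one _
          _ = t⁻¹ := by rw [Real.rpow_neg_one, mul_one]
          _ ≤ (4 / δ)⁻¹ := by gcongr
          _ = δ / 4 := by rw [inv_div]
      simp only [c1, PiLp.toLp_apply, Matrix.cons_val_zero, Matrix.cons_val_one, sub_zero]
      linarith
  · have a1 : (((Finset.range (⌊1 / (δ / 4)⌋₊ + 1)).image c1 ∪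
        (Finset.range (⌊L / η⌋₊ + 1)).image c2).card : ℝ) ≤
        ((⌊1 / (δ / 4)⌋₊ + 1 : ℕ) : ℝ) + ((⌊L / η⌋₊ + 1 : ℕ) : ℝ) := by
      rw [← Nat.cast_add, Nat.cast_le]
      refine (Finset.card_union_le _ _).trans (add_le_add ?_ ?_) <;>
      exact Finset.card_image_le.trans (by simp)
    refine a1.trans ?_
    push_cast
    have b1 := Nat.floor_le (by positivity : 0 ≤ 1 / (δ / 4))
    have b2 := Nat.floor_le (by positivity : 0 ≤ L / η)
    have e1 : 1 / (δ / 4) = 4 / δ := by field_simp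
    have e2 : L / η = 2 * K * L / δ := by rw [hη]; field_simp
    have e3 : 1 ≤ 1 / δ := by rw [le_div_iff₀ hδ]; linarith
    have e4 : (6 + 2 * K * L) / δ = 4 / δ + 2 * (1 / δ) + 2 * K * L / δ := by ring
    rw [e4]
    linarith

lemma aux_cover (p q θ s ε : ℝ) (hp : 0 < p) (hpq : 1 ≤ p * q) (hθ' : θ ≤ 1)
    (hs : 1 < s) (hε : 0 < ε) :
    ∃ δ₀ : ℝ, 0 < δ₀ ∧ ∀ δ : ℝ, 0 < δ → δ < δ₀ →
    ∃ 𝒰 : Set (Set (EuclideanSpace ℝ (Fin 2))), 𝒰.Countable ∧ attenTopSine p q ⊆ ⋃₀ 𝒰 ∧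
      (∀ U ∈ 𝒰, δ ≤ diam U ∧ diam U ≤ δ ^ θ) ∧
      ∑' U : 𝒰, ENNReal.ofReal (diam (U : Set (EuclideanSpace ℝ (Fin 2))) ^ s)
        ≤ ENNReal.ofReal ε := by
  classical
  set K := p + p * q + Real.pi with hK
  have hs' : 0 < s - 1 := by linarith
  have T1 := tendsto_log_mul_rpow_nhdsGT_zero hs'
  have T2 : Tendsto (fun x : ℝ => x ^ (s - 1)) (nhdsWithin 0 (Ioi 0)) (nhds 0) := by
    have := (Real.continuousAt_rpow_const 0 (s - 1) (Or.inr hs'.le)).tendsto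
    rw [Real.zero_rpow hs'.ne'] at this
    exact this.mono_left nhdsWithin_le_nhds
  have T3 := (T2.const_mul (6 + 2 * K * Real.log 4)).sub (T1.const_mul (2 * K))
  simp only [mul_zero, sub_zero] at T3
  have E := T3.eventually (gt_mem_nhds hε)
  obtain ⟨d, hd, hsub⟩ := mem_nhdsGT_iff_exists_Ioo_subset.1 E
  have hd0 : 0 < d := hd
  refine ⟨min d 1, by positivity, fun δ hδ hδd => ?_⟩
  have hδ1 : δ < 1 := hδd.trans_le (min_le_right _ _)
  have hbound := hsub ⟨hδ, hδd.trans_le (min_le_left _ _)⟩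
  simp only [mem_setOf_eq] at hbound
  obtain ⟨F, hF, hcard⟩ := aux_centers p q δ hp hpq hδ hδ1
  have hdiam : ∀ c : EuclideanSpace ℝ (Fin 2), diam (closedBall c (δ / 2)) = δ := fun c => by
    rw [Metric.diam_closedBall_eq c (by positivity)]; ring
  let 𝒰 : Finset (Set (EuclideanSpace ℝ (Fin 2))) := F.image (fun c => closedBall c (δ / 2))
  have hU : ∀ U ∈ 𝒰, diam U = δ := by
    intro U hU
    obtain ⟨c, _, rfl⟩ := Finset.mem_image.1 hU
    exact hdiam c
  refine ⟨(𝒰 : Set (Set (EuclideanSpace ℝ (Fin 2)))), 𝒰.countable_toSet, ?_, ?_, ?_⟩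
  · intro x hx
    obtain ⟨c, hc, hxc⟩ := hF x hx
    exact ⟨closedBall c (δ / 2), Finset.mem_coe.2 (Finset.mem_image_of_mem _ hc), hxc⟩
  · intro U hU'
    rw [hU U hU']
    refine ⟨le_rfl, ?_⟩
    simpa using Real.rpow_le_rpow_of_exponent_ge hδ hδ1.le hθ'
  · rw [Finset.tsum_subtype' 𝒰 (fun U => ENNReal.ofReal (diam U ^ s)),
      Finset.sum_congr rfl (fun U hU' => by rw [hU U hU']), Finset.sum_const, nsmul_eq_mul,
      ← ENNReal.ofReal_natCast, ← ENNReal.ofReal_mul (by positivity)]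
    apply ENNReal.ofReal_le_ofReal
    have hc : (𝒰.card : ℝ) ≤ F.card := by exact_mod_cast Finset.card_image_le
    have hlog : Real.log (4 / δ) = Real.log 4 - Real.log δ := Real.log_div (by norm_num) hδ.ne'
    have hpow : δ ^ s = δ * δ ^ (s - 1) := by
      rw [Real.rpow_sub_one hδ.ne']; field_simp
    calc (𝒰.card : ℝ) * δ ^ s
        ≤ ((6 + 2 * K * Real.log (4 / δ)) / δ) * δ ^ s := by
          gcongr
          exact hc.trans hcard
      _ = (6 + 2 * K * Real.log 4) * δ ^ (s - 1) - 2 * K * (Real.log δ * δ ^ (s - 1)) := by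
          rw [hpow, hlog]; field_simp; ring
      _ ≤ ε := hbound.le

lemma aux_lower (p q θ s δ : ℝ) (hp : 0 < p) (hθ : 0 < θ) (hs : s < 1)
    (hδ : 0 < δ) (hδ1 : δ < 1) (𝒰 : Set (Set (EuclideanSpace ℝ (Fin 2))))
    (hc : 𝒰.Countable) (hcov : attenTopSine p q ⊆ ⋃₀ 𝒰)
    (hU : ∀ U ∈ 𝒰, δ ≤ diam U ∧ diam U ≤ δ ^ θ)
    (hsum : ∑' U : 𝒰, ENNReal.ofReal (diam (U : Set (EuclideanSpace ℝ (Fin 2))) ^ s)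
        ≤ ENNReal.ofReal (1 / 2)) : False := by
  have hlip : LipschitzWith 1 (fun x : EuclideanSpace ℝ (Fin 2) => x 0) :=
    LipschitzWith.of_dist_le_mul fun x y => by
      simpa [Real.dist_eq, dist_eq_norm] using PiLp.norm_apply_le (x - y) 0
  have hsub : Ioc (0 : ℝ) 1 ⊆ ⋃ U ∈ 𝒰, (fun x : EuclideanSpace ℝ (Fin 2) => x 0) '' U := by
    intro a ha
    have ha0 : 0 < a := ha.1
    let t := a ^ (-(1 / p))
    have ht : 1 ≤ t := Real.one_le_rpow_of_pos_of_le_one_of_nonpos ha0 ha.2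
      (by simp only [Left.neg_nonpos_iff]; positivity)
    have hta : t ^ (-p) = a := by
      rw [← Real.rpow_mul ha0.le]
      have : -(1 / p) * -p = 1 := by field_simp
      rw [this, Real.rpow_one]
    have hx : (!₂[t ^ (-p), t ^ (-(p * q)) * Real.sin (Real.pi * t)] : EuclideanSpace ℝ (Fin 2))
        ∈ attenTopSine p q := ⟨t, ht, by simp, by simp⟩
    obtain ⟨U, hU, hxU⟩ := hcov hx
    exact mem_biUnion hU ⟨_, hxU, by simpa using hta⟩
  have h1 : (1 : ENNReal) ≤ ENNReal.ofReal (1 / 2) := by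
    calc (1 : ENNReal) = MeasureTheory.volume (Ioc (0 : ℝ) 1) := by simp
      _ ≤ MeasureTheory.volume (⋃ U ∈ 𝒰, (fun x : EuclideanSpace ℝ (Fin 2) => x 0) '' U) :=
          MeasureTheory.measure_mono hsub
      _ ≤ ∑' U : 𝒰, MeasureTheory.volume
            ((fun x : EuclideanSpace ℝ (Fin 2) => x 0) '' (U : Set (EuclideanSpace ℝ (Fin 2)))) :=
          MeasureTheory.measure_biUnion_le _ hc _
      _ ≤ ∑' U : 𝒰, ENNReal.ofReal (diam (U : Set (EuclideanSpace ℝ (Fin 2))) ^ s) := by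
          refine ENNReal.tsum_le_tsum fun U => ?_
          obtain ⟨hl, hu⟩ := hU U U.2
          have hpos : 0 < diam (U : Set (EuclideanSpace ℝ (Fin 2))) := hδ.trans_le hl
          have hle1 : diam (U : Set (EuclideanSpace ℝ (Fin 2))) ≤ 1 :=
            hu.trans (Real.rpow_le_one hδ.le hδ1.le hθ.le)
          have hbd : ediam (U : Set (EuclideanSpace ℝ (Fin 2))) ≠ ⊤ := by
            intro h
            rw [diam, h] at hpos
            simp at hpos
          calc _ ≤ ediam ((fun x : EuclideanSpace ℝ (Fin 2) => x 0) ''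
                (U : Set (EuclideanSpace ℝ (Fin 2)))) := Real.volume_le_diam _
            _ ≤ (1 : NNReal) * ediam (U : Set (EuclideanSpace ℝ (Fin 2))) :=
                hlip.ediam_image_le _
            _ = ENNReal.ofReal (diam (U : Set (EuclideanSpace ℝ (Fin 2)))) := by
                rw [diam, ENNReal.ofReal_toReal hbd]; simp
            _ ≤ _ := by
                apply ENNReal.ofReal_le_ofReal
                simpa using Real.rpow_le_rpow_of_exponent_ge hpos hle1 hs.le
      _ ≤ _ := hsum
  rw [ENNReal.one_le_ofReal] at h1
  norm_num at h1

lemma aux_sInf (A : Set ℝ) (h1 : ∀ s ∈ A, 1 ≤ s) (h2 : ∀ s, 1 < s → s ∈ A) : sInf A = 1 := by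
  refine csInf_eq_of_forall_ge_of_forall_gt_exists_lt ⟨2, h2 2 (by norm_num)⟩ h1 ?_
  intro w hw
  obtain ⟨z, hz, hz'⟩ := exists_between hw
  exact ⟨z, h2 z hz, hz'⟩

theorem stmt17 (p q θ : ℝ) (hp : 0 < p) (hq : 0 < q) (hpq : 1 ≤ p * q)
    (hθ : 0 < θ) (hθ' : θ ≤ 1) :
    lodim θ (attenTopSine p q) = 1 ∧ updim θ (attenTopSine p q) = 1 := by
  constructor
  · apply aux_sInf
    · rintro s ⟨_, h⟩
      by_contra! hs
      obtain ⟨δ, hδ, hδ1, 𝒰, hc, hcov, hU, hsum⟩ := h (1 / 2) (by norm_num) 1 one_pos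
      exact aux_lower p q θ s δ hp hθ hs hδ hδ1 𝒰 hc hcov hU hsum
    · intro s hs
      refine ⟨by linarith, fun ε hε δ₀ hδ₀ => ?_⟩
      obtain ⟨d, hd, h⟩ := aux_cover p q θ s ε hp hpq hθ' hs hε
      have hm : 0 < min d δ₀ := lt_min hd hδ₀
      refine ⟨min d δ₀ / 2, by positivity, ?_, h _ (by positivity) ?_⟩
      · linarith [min_le_right d δ₀]
      · linarith [min_le_left d δ₀]
  · apply aux_sInf
    · rintro s ⟨_, h⟩
      by_contra! hs
      obtain ⟨d, hd, h⟩ := h (1 / 2) (by norm_num)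
      have hm : 0 < min d 1 := lt_min hd one_pos
      obtain ⟨𝒰, hc, hcov, hU, hsum⟩ := h (min d 1 / 2) (by positivity)
        (by linarith [min_le_left d 1])
      exact aux_lower p q θ s _ hp hθ hs (by positivity) (by linarith [min_le_right d 1])
        𝒰 hc hcov hU hsum
    · intro s hs
      exact ⟨by linarith, fun ε hε => aux_cover p q θ s ε hp hpq hθ' hs hε⟩
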